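/- arXiv:1703.10910 — 6 statements merged into one kernel-verified Lean document; each statement's English description precedes it below -/
import Mathlib

section
/- Let n ≥ 2 and m ≥ 1, let f be a Z_n-linear endomorphism of the module (Z_n)^m, and let s be the system height of the linear finite dynamical system ((Z_n)^m, f). If the prime factorization of n is p_1^{α_1} p_2^{α_2} ⋯ p_ω^{α_ω}, then s ≤ m · max{α_1, α_2, …, α_ω}, i.e., the system height is at most m times the largest exponent occurring in the prime factorization of n. -/
/-- An element `x` is a cycle vertex of the system `(M, f)` if `f^[l] x = x`
for some positive integer `l`. -/
def IsCycleVertex {M : Type*} (f : M → M) (x : M) : Prop :=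
  ∃ l : ℕ, 0 < l ∧ f^[l] x = x

/-- The height of an element `x`: the least `k` such that `f^[k] x` is a cycle vertex. -/
noncomputable def height {M : Type*} (f : M → M) (x : M) : ℕ :=
  sInf {k : ℕ | IsCycleVertex f (f^[k] x)}

/-- The system height: the maximum height over all elements. -/
noncomputable def systemHeight {M : Type*} (f : M → M) : ℕ :=
  sSup (Set.range (height f))

open Polynomial in
/-- If the powers of `F` are eventually periodic with period `N` and `F ^ m - F ^ (m + N)` is
nilpotent of exponent `A`, then the powers of `F` are periodic from exponent `m * A` on. -/
theorem pow_mul_eq_pow_mul_add_of_pow_sub_eq_zero {R : Type*} [Ring R] (F : R) {a N m A : ℕ}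
    (hN : 0 < N) (hper : F ^ a = F ^ (a + N)) (hnil : (F ^ m - F ^ (m + N)) ^ A = 0) :
    F ^ (m * A) = F ^ (m * A + N) := by
  have hcop : IsCoprime ((X : ℤ[X]) ^ a) ((1 - X ^ N) ^ A) := by
    refine IsCoprime.pow ⟨X ^ (N - 1), 1, ?_⟩
    rw [← pow_succ, Nat.sub_add_cancel hN]
    ring
  obtain ⟨s, t, hst⟩ := hcop
  have key : (X : ℤ[X]) ^ (m * A) - X ^ (m * A + N) =
      s * X ^ (m * A) * (X ^ a - X ^ (a + N)) +
        t * (1 - X ^ N) * (X ^ m - X ^ (m + N)) ^ A := by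
    have h1 : (X ^ m - X ^ (m + N) : ℤ[X]) ^ A = X ^ (m * A) * (1 - X ^ N) ^ A := by
      rw [pow_mul, ← mul_pow]
      ring
    rw [h1]
    linear_combination (-(X : ℤ[X]) ^ (m * A) * (1 - X ^ N)) * hst
  have := congrArg (aeval F) key
  simp only [map_sub, map_add, map_mul, map_pow, aeval_X, hnil, sub_eq_zero.mpr hper,
    mul_zero, add_zero] at this
  exact sub_eq_zero.mp this

/-- Over a field, eventual periodicity of the powers of an `m × m` matrix starts at exponent `m`
at the latest. -/
theorem Matrix.pow_card_eq_pow_card_add {K : Type*} [Field K] {m a N : ℕ}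
    (F : Matrix (Fin m) (Fin m) K) (hper : F ^ a = F ^ (a + N)) : F ^ m = F ^ (m + N) := by
  apply (Matrix.toLinAlgEquiv' (R := K) (n := Fin m)).injective
  have hper' := congrArg (Matrix.toLinAlgEquiv' (R := K) (n := Fin m)) hper
  simp only [map_pow] at hper' ⊢
  set g := Matrix.toLinAlgEquiv' F
  refine LinearMap.ext fun x => ?_
  have hy : x - (g ^ N) x ∈ LinearMap.ker (g ^ a) := by
    rw [LinearMap.mem_ker, map_sub, ← Module.End.mul_apply, ← pow_add, ← hper', sub_self]
  have hy' := Module.End.ker_pow_le_ker_pow_finrank g a hy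
  rw [Module.finrank_fin_fun, LinearMap.mem_ker, map_sub, ← Module.End.mul_apply, ← pow_add,
    sub_eq_zero] at hy'
  exact hy'

/-- A square matrix over `ZMod n` that vanishes modulo each prime factor of `n` is nilpotent, of
exponent at most the largest exponent in the factorization of `n`. -/
theorem ZMod.matrix_pow_sup_eq_zero {n m ω : ℕ} [NeZero n] {p α : Fin ω → ℕ}
    (hp : ∀ i, (p i).Prime) (hpinj : Function.Injective p)
    (hfac : n = ∏ i, p i ^ α i) (hdvd : ∀ i, p i ∣ n) (D : Matrix (Fin m) (Fin m) (ZMod n))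
    (hD : ∀ i, D.map (ZMod.castHom (hdvd i) (ZMod (p i))) = 0) :
    D ^ Finset.univ.sup α = 0 := by
  have hentry : ∀ j k, ((∏ i, p i : ℕ) : ZMod n) ∣ D j k := by
    intro j k
    have h : ∏ i, p i ∣ (D j k).val := by
      refine Fintype.prod_dvd_of_isRelPrime ?_ fun i => ?_
      · intro i i' hii
        exact Nat.coprime_iff_isRelPrime.mp
          ((Nat.coprime_primes (hp i) (hp i')).mpr fun h => hii (hpinj h))
      · rw [← ZMod.natCast_eq_zero_iff, ZMod.natCast_val]
        exact congrFun (congrFun (hD i) j) k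
    have := Nat.cast_dvd_cast (α := ZMod n) h
    rwa [ZMod.natCast_zmod_val] at this
  choose E hE using hentry
  have hDE : D = ((∏ i, p i : ℕ) : ZMod n) • Matrix.of E := by
    ext j k
    simp [hE j k]
  have hzero : ((∏ i, p i : ℕ) : ZMod n) ^ Finset.univ.sup α = 0 := by
    rw [← Nat.cast_pow, ZMod.natCast_eq_zero_iff, ← Finset.prod_pow]
    conv_lhs => rw [hfac]
    exact Finset.prod_dvd_prod_of_dvd _ _ fun i _ =>
      pow_dvd_pow _ (Finset.le_sup (Finset.mem_univ i))
  rw [hDE, smul_pow, hzero, zero_smul]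

/-- **Theorem A (function independent bound).** If `n = ∏ pᵢ^αᵢ` is the prime
factorization of `n`, then the system height of `((ZMod n)^m, f)` is at most
`m * max αᵢ`. -/
theorem systemHeight_le_mul_sup_exponents
    (n m ω : ℕ) (hn : 2 ≤ n) (hm : 1 ≤ m)
    (p α : Fin ω → ℕ) (hp : ∀ i, (p i).Prime) (hpinj : Function.Injective p)
    (hα : ∀ i, 1 ≤ α i) (hfac : n = ∏ i, p i ^ α i)
    (f : (Fin m → ZMod n) →ₗ[ZMod n] (Fin m → ZMod n)) :
    systemHeight ⇑f ≤ m * Finset.univ.sup α := by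
  have : NeZero n := ⟨by omega⟩
  have hdvd : ∀ i, p i ∣ n := fun i => by
    rw [hfac]
    exact (dvd_pow_self _ (Nat.one_le_iff_ne_zero.mp (hα i))).trans
      (Finset.dvd_prod_of_mem _ (Finset.mem_univ i))
  set F := LinearMap.toMatrixAlgEquiv' f with hF
  obtain ⟨a, N, hN, hper⟩ : ∃ a N, 0 < N ∧ F ^ a = F ^ (a + N) := by
    obtain ⟨i, j, hij, h⟩ := Finite.exists_ne_map_eq_of_infinite (F ^ · : ℕ → _)
    rcases hij.lt_or_gt with hlt | hlt
    · exact ⟨i, j - i, by omega, by rw [Nat.add_sub_cancel' hlt.le]; exact h⟩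
    · exact ⟨j, i - j, by omega, by rw [Nat.add_sub_cancel' hlt.le]; exact h.symm⟩
  have hnil : (F ^ m - F ^ (m + N)) ^ Finset.univ.sup α = 0 := by
    refine ZMod.matrix_pow_sup_eq_zero hp hpinj hfac hdvd _ fun i => ?_
    have : Fact (p i).Prime := ⟨hp i⟩
    have hper' := congrArg (ZMod.castHom (hdvd i) (ZMod (p i))).mapMatrix hper
    rw [map_pow, map_pow] at hper'
    rw [← RingHom.mapMatrix_apply, map_sub, map_pow, map_pow,
      ← Matrix.pow_card_eq_pow_card_add _ hper', sub_self]
  have hF' := pow_mul_eq_pow_mul_add_of_pow_sub_eq_zero F hN hper hnil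
  rw [hF, ← map_pow, ← map_pow] at hF'
  have hf := LinearMap.toMatrixAlgEquiv'.injective hF'
  refine csSup_le (Set.range_nonempty _) ?_
  rintro _ ⟨x, rfl⟩
  refine Nat.sInf_le ⟨N, hN, ?_⟩
  rw [← Function.iterate_add_apply, add_comm, ← Module.End.pow_apply, ← Module.End.pow_apply, hf]
end

section
/- Let n ≥ 2 and m ≥ 1, let A be an m × m matrix over Z_n, and let s be the system height of the linear finite dynamical system ((Z_n)^m, x ↦ A x). If the prime factorization of n is p_1^{α_1} p_2^{α_2} ⋯ p_ω^{α_ω}, then s ≤ max{α_1 s_1, α_2 s_2, …, α_ω s_ω}, where for each i, s_i denotes the system height of the reduced system ((Z_{p_i})^m, x ↦ (A mod p_i) x) given by reducing the entries of A modulo p_i. -/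
theorem IsCycleVertex.iterate {M : Type*} {f : M → M} {x : M} (h : IsCycleVertex f x) (k : ℕ) :
    IsCycleVertex f (f^[k] x) := by
  obtain ⟨l, hl, hx⟩ := h
  exact ⟨l, hl, by rw [← Function.iterate_add_apply, add_comm, Function.iterate_add_apply, hx]⟩

theorem exists_isCycleVertex_iterate {M : Type*} [Finite M] (f : M → M) (x : M) :
    ∃ k, IsCycleVertex f (f^[k] x) := by
  obtain ⟨a, b, hab, h⟩ := Finite.exists_ne_map_eq_of_infinite fun k : ℕ => f^[k] x
  wlog hlt : a < b generalizing a b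
  · exact this b a hab.symm h.symm (by omega)
  refine ⟨a, b - a, by omega, ?_⟩
  rw [← Function.iterate_add_apply, Nat.sub_add_cancel hlt.le]
  exact h.symm

theorem isCycleVertex_iterate_systemHeight {M : Type*} [Finite M] (f : M → M) (x : M) :
    IsCycleVertex f (f^[systemHeight f] x) := by
  have hle : height f x ≤ systemHeight f :=
    le_csSup (Set.finite_range _).bddAbove (Set.mem_range_self x)
  have hmem : IsCycleVertex f (f^[height f x] x) :=
    Nat.sInf_mem (exists_isCycleVertex_iterate f x)
  have := hmem.iterate (systemHeight f - height f x)
  rwa [← Function.iterate_add_apply, Nat.sub_add_cancel hle] at this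

theorem systemHeight_le_of_forall_isCycleVertex {M : Type*} [Nonempty M] {f : M → M} {k : ℕ}
    (h : ∀ x, IsCycleVertex f (f^[k] x)) : systemHeight f ≤ k := by
  refine csSup_le (Set.range_nonempty _) ?_
  rintro _ ⟨x, rfl⟩
  exact Nat.sInf_le (h x)

theorem Monoid.exists_pos_isIdempotentElem_pow {G : Type*} [Monoid G] [Finite G] (a : G) :
    ∃ l, 0 < l ∧ IsIdempotentElem (a ^ l) := by
  obtain ⟨i, j, hij, h⟩ := Finite.exists_ne_map_eq_of_infinite fun k : ℕ => a ^ k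
  wlog hlt : i < j generalizing i j
  · exact this j i hij.symm h.symm (by omega)
  obtain ⟨d, rfl⟩ := Nat.exists_eq_add_of_lt hlt
  have hper : ∀ t, a ^ (i + t * (d + 1)) = a ^ i := by
    intro t
    induction t with
    | zero => simp
    | succ t ih =>
      rw [show i + (t + 1) * (d + 1) = i + t * (d + 1) + (d + 1) by ring, pow_add, ih, ← pow_add]
      exact h.symm
  refine ⟨(i + 1) * (d + 1), by positivity, ?_⟩
  have hle : i ≤ (i + 1) * (d + 1) := by nlinarith
  obtain ⟨r, hr⟩ := Nat.exists_eq_add_of_le hle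
  rw [IsIdempotentElem, ← pow_add]
  calc a ^ ((i + 1) * (d + 1) + (i + 1) * (d + 1))
      = a ^ (i + (i + 1) * (d + 1)) * a ^ r := by rw [← pow_add]; congr 1; omega
    _ = a ^ ((i + 1) * (d + 1)) := by rw [hper, ← pow_add, ← hr]

theorem Matrix.iterate_mulVec {ι R : Type*} [Fintype ι] [DecidableEq ι] [CommSemiring R]
    (A : Matrix ι ι R) (k : ℕ) (x : ι → R) : A.mulVec^[k] x = (A ^ k).mulVec x := by
  induction k with
  | zero => simp
  | succ k ih => rw [Function.iterate_succ_apply', ih, Matrix.mulVec_mulVec, pow_succ']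

theorem IsCycleVertex.pow_mulVec_eq {ι R : Type*} [Fintype ι] [DecidableEq ι] [CommSemiring R]
    {A : Matrix ι ι R} {l : ℕ} (hidem : IsIdempotentElem (A ^ l)) {x : ι → R}
    (hx : IsCycleVertex A.mulVec x) : (A ^ l).mulVec x = x := by
  obtain ⟨c, hc, hcx⟩ := hx
  have hfix : ((A ^ l) ^ c).mulVec x = x := by
    rw [← pow_mul, mul_comm l, ← Matrix.iterate_mulVec, Function.iterate_mul]
    exact Function.iterate_fixed hcx l
  rwa [hidem.pow_eq hc.ne'] at hfix

/-- Multiplying by `A ^ systemHeight` annihilates the complement of an idempotent power of `A`. -/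
theorem Matrix.pow_systemHeight_mul_one_sub_pow {ι R : Type*} [Fintype ι] [DecidableEq ι]
    [CommRing R] [Finite R] {A : Matrix ι ι R} {l : ℕ} (hidem : IsIdempotentElem (A ^ l)) :
    A ^ systemHeight A.mulVec * (1 - A ^ l) = 0 := by
  refine Matrix.ext_of_mulVec_single fun i => ?_
  have h := (isCycleVertex_iterate_systemHeight A.mulVec (Pi.single i 1)).pow_mulVec_eq hidem
  rw [Matrix.iterate_mulVec, Matrix.mulVec_mulVec] at h
  rw [mul_sub, mul_one, (Commute.pow_pow_self A _ _).eq, Matrix.sub_mulVec, h, sub_self,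
    Matrix.zero_mulVec]

theorem ZMod.natCast_dvd_iff_dvd_val {n q : ℕ} [NeZero n] (hq : q ∣ n) (z : ZMod n) :
    (q : ZMod n) ∣ z ↔ q ∣ z.val := by
  constructor
  · rintro ⟨w, rfl⟩
    rw [← ZMod.natCast_eq_zero_iff, ← ZMod.cast_eq_val,
      ← ZMod.castHom_apply (h := hq), map_mul, map_natCast, ZMod.natCast_self, zero_mul]
  · intro h
    rw [← ZMod.natCast_zmod_val z]
    exact Nat.cast_dvd_cast h

/-- The matrix bound at a single prime: `q ^ a` divides `A ^ (a * s) * (1 - A ^ l)`. -/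
theorem Matrix.natCast_pow_dvd_pow_mul_one_sub_pow {ι : Type*} [Fintype ι] [DecidableEq ι]
    {n q a l : ℕ} [NeZero n] [NeZero q] (hq : q ∣ n) (ha : a ≠ 0)
    {A : Matrix ι ι (ZMod n)} (hidem : IsIdempotentElem (A ^ l)) :
    ∃ B : Matrix ι ι (ZMod n),
      A ^ (a * systemHeight ((A.map (ZMod.cast : ZMod n → ZMod q)).mulVec)) * (1 - A ^ l) =
        (q : ZMod n) ^ a • B := by
  set s := systemHeight ((A.map (ZMod.cast : ZMod n → ZMod q)).mulVec) with hs
  let φ := (ZMod.castHom hq (ZMod q)).mapMatrix (m := ι)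
  have hφ : A.map (ZMod.cast : ZMod n → ZMod q) = φ A := rfl
  have hzero : φ (A ^ s * (1 - A ^ l)) = 0 := by
    have hidem' : IsIdempotentElem (φ A ^ l) := by
      rw [← map_pow]
      exact hidem.map φ
    rw [map_mul, map_sub, map_one, map_pow, map_pow, hs, hφ]
    exact Matrix.pow_systemHeight_mul_one_sub_pow hidem'
  have hdvd : ∀ i j, (q : ZMod n) ∣ (A ^ s * (1 - A ^ l)) i j := by
    intro i j
    rw [ZMod.natCast_dvd_iff_dvd_val hq, ← ZMod.natCast_eq_zero_iff, ← ZMod.cast_eq_val]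
    exact congrFun (congrFun hzero i) j
  choose B hB using hdvd
  have hfac : A ^ s * (1 - A ^ l) = (q : ZMod n) • (Matrix.of B) := by
    ext i j
    simpa using hB i j
  have hcomm : Commute (A ^ s) (1 - A ^ l) :=
    (Commute.one_right _).sub_right (Commute.pow_pow_self A _ _)
  refine ⟨Matrix.of B ^ a, ?_⟩
  rw [← smul_pow, ← hfac, hcomm.mul_pow, hidem.one_sub.pow_eq ha, ← pow_mul, mul_comm s]

/-- **Theorem B (function dependent bound).** If `n = ∏ pᵢ^αᵢ` is the prime
factorization of `n`, then the system height of `((ZMod n)^m, x ↦ A x)` is at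
most `max αᵢ sᵢ`, where `sᵢ` is the system height of the reduced system
`((ZMod pᵢ)^m, x ↦ (A mod pᵢ) x)`. -/
theorem systemHeight_le_sup_exponent_mul_reducedHeight
    (n m ω : ℕ) (hn : 2 ≤ n) (hm : 1 ≤ m)
    (p α : Fin ω → ℕ) (hp : ∀ i, (p i).Prime) (hpinj : Function.Injective p)
    (hα : ∀ i, 1 ≤ α i) (hfac : n = ∏ i, p i ^ α i)
    (A : Matrix (Fin m) (Fin m) (ZMod n)) :
    systemHeight A.mulVec ≤
      Finset.univ.sup (fun i =>
        α i * systemHeight ((A.map (ZMod.cast : ZMod n → ZMod (p i))).mulVec)) := by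
  have : NeZero n := ⟨by omega⟩
  set S := Finset.univ.sup (fun i =>
    α i * systemHeight ((A.map (ZMod.cast : ZMod n → ZMod (p i))).mulVec))
  obtain ⟨l, hl, hidem⟩ := Monoid.exists_pos_isIdempotentElem_pow A
  have hpow : ∀ i, p i ^ α i ∣ n := fun i => hfac ▸ Finset.dvd_prod_of_mem _ (Finset.mem_univ i)
  have hdvd : ∀ i j k, p i ^ α i ∣ ((A ^ S * (1 - A ^ l)) j k).val := by
    intro i j k
    have : NeZero (p i) := ⟨(hp i).ne_zero⟩
    have hαi : α i ≠ 0 := Nat.one_le_iff_ne_zero.mp (hα i)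
    obtain ⟨B, hB⟩ := Matrix.natCast_pow_dvd_pow_mul_one_sub_pow
      ((dvd_pow_self _ hαi).trans (hpow i)) hαi hidem
    have hle : α i * systemHeight ((A.map (ZMod.cast : ZMod n → ZMod (p i))).mulVec) ≤ S :=
      Finset.le_sup (f := fun i =>
        α i * systemHeight ((A.map (ZMod.cast : ZMod n → ZMod (p i))).mulVec)) (Finset.mem_univ i)
    rw [← ZMod.natCast_dvd_iff_dvd_val (hpow i), ← Nat.sub_add_cancel hle, pow_add, mul_assoc, hB,
      Matrix.mul_smul, Nat.cast_pow]
    exact Dvd.intro _ rfl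
  have hzero : A ^ S * (1 - A ^ l) = 0 := by
    ext j k
    have hprod : ∏ i, p i ^ α i ∣ ((A ^ S * (1 - A ^ l)) j k).val := by
      refine Finset.prod_dvd_of_isRelPrime (fun a _ b _ hab => ?_) fun i _ => hdvd i j k
      exact Nat.coprime_iff_isRelPrime.mp
        (Nat.Coprime.pow _ _ ((Nat.coprime_primes (hp a) (hp b)).mpr (hpinj.ne hab)))
    rw [← hfac] at hprod
    exact (ZMod.val_eq_zero _).mp (Nat.eq_zero_of_dvd_of_lt hprod (ZMod.val_lt _))
  refine systemHeight_le_of_forall_isCycleVertex fun x => ⟨l, hl, ?_⟩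
  rw [mul_sub, mul_one, sub_eq_zero, (Commute.pow_pow_self A _ _).eq] at hzero
  rw [Matrix.iterate_mulVec, Matrix.iterate_mulVec, Matrix.mulVec_mulVec, ← hzero]
end

section
/- Let n ≥ 2 and m ≥ 1, let f be a Z_n-linear endomorphism of (Z_n)^m, and let s be the system height of the linear finite dynamical system ((Z_n)^m, f). Then s ≤ m · Ω(n), where Ω(n) is the number of prime factors of n counted with multiplicity. -/
open ArithmeticFunction in
/-- The number of prime factors of the order strictly increases along a strict inclusion
of finite subgroups. -/
theorem AddSubgroup.cardFactors_card_lt_of_lt {G : Type*} [AddGroup G] [Finite G]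
    {H K : AddSubgroup G} (h : H < K) :
    cardFactors (Nat.card H) < cardFactors (Nat.card K) := by
  obtain ⟨c, hc⟩ := AddSubgroup.card_dvd_of_le h.le
  have hK : Nat.card K ≠ 0 := Nat.card_pos.ne'
  have hH : Nat.card H ≠ 0 := Nat.card_pos.ne'
  have hc0 : c ≠ 0 := by
    rintro rfl
    exact hK (by simpa using hc)
  have hc1 : c ≠ 1 := by
    rintro rfl
    exact h.ne (AddSubgroup.eq_of_le_of_card_ge h.le (by simp [hc]))
  rw [hc, cardFactors_mul hH hc0]
  have : cardFactors c ≠ 0 := by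
    rw [Ne, cardFactors_eq_zero_iff_eq_zero_or_one]
    tauto
  omega

theorem Submodule.cardFactors_card_lt_of_lt {R M : Type*} [Ring R] [AddCommGroup M] [Module R M]
    [Finite M] {p q : Submodule R M} (h : p < q) :
    ArithmeticFunction.cardFactors (Nat.card p) < ArithmeticFunction.cardFactors (Nat.card q) :=
  AddSubgroup.cardFactors_card_lt_of_lt (Submodule.toAddSubgroup_strictMono h)

theorem Module.End.range_pow_succ_le {R M : Type*} [Ring R] [AddCommGroup M] [Module R M]
    (f : Module.End R M) (k : ℕ) : LinearMap.range (f ^ (k + 1)) ≤ LinearMap.range (f ^ k) := by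
  rw [pow_succ]
  exact LinearMap.range_comp_le_range f (f ^ k)

theorem Module.End.map_range_pow {R M : Type*} [Ring R] [AddCommGroup M] [Module R M]
    (f : Module.End R M) (k : ℕ) :
    (LinearMap.range (f ^ k)).map f = LinearMap.range (f ^ (k + 1)) := by
  rw [pow_succ', Module.End.mul_eq_comp, LinearMap.range_comp]

/-- The iterated ranges of an endomorphism of a finite module stabilize after at most
as many steps as the order of the module has prime factors. -/
theorem Module.End.range_pow_succ_eq_of_cardFactors_le
    {R M : Type*} [Ring R] [AddCommGroup M] [Module R M] [Finite M]
    (f : Module.End R M) {k : ℕ} (hk : ArithmeticFunction.cardFactors (Nat.card M) ≤ k) :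
    LinearMap.range (f ^ (k + 1)) = LinearMap.range (f ^ k) := by
  have key : ∀ j, LinearMap.range (f ^ (j + 1)) = LinearMap.range (f ^ j) ∨
      ArithmeticFunction.cardFactors (Nat.card (LinearMap.range (f ^ (j + 1)))) + (j + 1) ≤
        ArithmeticFunction.cardFactors (Nat.card M) := by
    intro j
    induction j with
    | zero =>
      rcases (Module.End.range_pow_succ_le f 0).eq_or_lt with h | h
      · exact Or.inl h
      · have h1 := Submodule.cardFactors_card_lt_of_lt (h.trans_le le_top)
        rw [Nat.card_congr Submodule.topEquiv.toEquiv] at h1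
        exact Or.inr h1
    | succ j ih =>
      rcases ih with ih | ih
      · left
        rw [← Module.End.map_range_pow, ih, Module.End.map_range_pow, ih]
      · rcases (Module.End.range_pow_succ_le f (j + 1)).eq_or_lt with h | h
        · exact Or.inl h
        · have h1 := Submodule.cardFactors_card_lt_of_lt h
          right
          omega
  rcases key k with h | h
  · exact h
  · omega

/-- A map sending a finite set onto itself makes every element of that set a cycle vertex. -/
theorem isCycleVertex_of_surjOn {M : Type*} {f : M → M} {s : Set M} (hs : s.Finite)
    (hmaps : Set.MapsTo f s s) (hsurj : Set.SurjOn f s s) {x : M} (hx : x ∈ s) :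
    IsCycleVertex f x := by
  have : Finite s := hs
  have hinj : Function.Injective (hmaps.restrict f s s) :=
    Finite.injective_iff_surjective.mpr ((Set.MapsTo.restrict_surjective_iff hmaps).mpr hsurj)
  obtain ⟨l, hl, hfix⟩ := hinj.mem_periodicPts ⟨x, hx⟩
  refine ⟨l, hl, ?_⟩
  have h := congrArg Subtype.val hfix
  rwa [hmaps.iterate_restrict] at h

theorem systemHeight_le_cardFactors_card {R M : Type*} [Ring R] [AddCommGroup M] [Module R M]
    [Finite M] (f : Module.End R M) :
    systemHeight f ≤ ArithmeticFunction.cardFactors (Nat.card M) := by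
  refine csSup_le' ?_
  rintro _ ⟨x, rfl⟩
  refine Nat.sInf_le ?_
  set k := ArithmeticFunction.cardFactors (Nat.card M)
  have hmap : f '' (LinearMap.range (f ^ k) : Set M) = LinearMap.range (f ^ k) := by
    rw [← Submodule.map_coe, Module.End.map_range_pow,
      Module.End.range_pow_succ_eq_of_cardFactors_le f le_rfl]
  refine isCycleVertex_of_surjOn (Set.toFinite (LinearMap.range (f ^ k) : Set M))
    (Set.mapsTo_iff_image_subset.mpr hmap.subset) hmap.superset ⟨x, ?_⟩
  rw [Module.End.coe_pow]

/-- The system height of `((ZMod n)^m, f)` is at most `m * Ω(n)`, where `Ω(n)`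
is the number of prime factors of `n` counted with multiplicity. -/
theorem systemHeight_le_mul_primeFactorsList_length
    (n m : ℕ) (hn : 2 ≤ n) (hm : 1 ≤ m)
    (f : (Fin m → ZMod n) →ₗ[ZMod n] (Fin m → ZMod n)) :
    systemHeight ⇑f ≤ m * n.primeFactorsList.length := by
  have : NeZero n := ⟨by omega⟩
  calc systemHeight ⇑f ≤ ArithmeticFunction.cardFactors (Nat.card (Fin m → ZMod n)) :=
        systemHeight_le_cardFactors_card f
    _ = m * n.primeFactorsList.length := by
      rw [Nat.card_fun, Nat.card_zmod, Nat.card_fin, ArithmeticFunction.cardFactors_pow,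
        ArithmeticFunction.cardFactors_apply]
end

section
/- Let p be a prime, r ≥ 1, m ≥ 1, and let f be a Z_{p^r}-linear endomorphism of (Z_{p^r})^m. Let N = ⟨p⟩^m and let f̄ be the induced endomorphism of (Z_{p^r})^m / N. If the coset v + N is a leaf of the quotient system lying in its nilpotent component (i.e., v + N is not in the image of f̄ and f̄^t(v + N) = N for some nonnegative integer t), then the coset v + N contains an element y of (Z_{p^r})^m that is a leaf of ((Z_{p^r})^m, f) lying in its nilpotent component (i.e., y is not in the image of f and f^s(y) = 0 for some nonnegative integer s). -/
open Filter in
/-- If a coset of a quotient of an Artinian and Noetherian module is nilpotent under the map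
induced by `f`, then it contains an element that is nilpotent under `f`. -/
theorem Module.End.exists_mk_eq_and_pow_apply_eq_zero {R M : Type*} [Ring R] [AddCommGroup M]
    [Module R M] [IsNoetherian R M] [IsArtinian R M] {N : Submodule R M}
    (f : Module.End R M) (g : Module.End R (M ⧸ N)) (hg : g ∘ₗ N.mkQ = N.mkQ ∘ₗ f)
    (v : M) (t : ℕ) (ht : (g ^ t) (N.mkQ v) = 0) :
    ∃ y : M, N.mkQ y = N.mkQ v ∧ ∃ s : ℕ, (f ^ s) y = 0 := by
  have hpow (n : ℕ) (x : M) : (g ^ n) (N.mkQ x) = N.mkQ ((f ^ n) x) := by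
    induction n with
    | zero => simp
    | succ n ih =>
      rw [pow_succ', pow_succ', Module.End.mul_apply, Module.End.mul_apply, ih]
      exact LinearMap.congr_fun hg _
  obtain ⟨n, ⟨hf, hg'⟩, hn⟩ := ((f.eventually_isCompl_ker_pow_range_pow.and
    g.eventually_isCompl_ker_pow_range_pow).and (eventually_ge_atTop t)).exists
  obtain ⟨y, hy, w, ⟨u, rfl⟩, hv⟩ :=
    Submodule.mem_sup.mp (hf.sup_eq_top ▸ Submodule.mem_top : v ∈ _)
  rw [LinearMap.mem_ker] at hy
  refine ⟨y, ?_, n, hy⟩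
  have hker : N.mkQ ((f ^ n) u) ∈ LinearMap.ker (g ^ n) := by
    have hgv : (g ^ n) (N.mkQ v) = 0 := by
      rw [← Nat.sub_add_cancel hn, pow_add, Module.End.mul_apply, ht, map_zero]
    rwa [← hv, map_add, map_add, hpow n y, hy, map_zero, zero_add] at hgv
  have hzero := Submodule.disjoint_def.mp hg'.disjoint _ hker ⟨N.mkQ u, hpow n u⟩
  rw [← hv, map_add, hzero, add_zero]


/-- If the coset `v + ⟨p⟩^m` is a leaf of the quotient system lying in its
nilpotent component, then it contains a leaf of `((ZMod (p^r))^m, f)` lying in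
the nilpotent component of that system. -/
theorem exists_nilpotent_leaf_in_coset
    (p r m : ℕ) (hp : p.Prime) (hr : 1 ≤ r) (hm : 1 ≤ m)
    (f : (Fin m → ZMod (p ^ r)) →ₗ[ZMod (p ^ r)] (Fin m → ZMod (p ^ r)))
    (N : Submodule (ZMod (p ^ r)) (Fin m → ZMod (p ^ r)))
    (hN : N = Submodule.pi Set.univ (fun _ => Ideal.span {(p : ZMod (p ^ r))}))
    (fbar : ((Fin m → ZMod (p ^ r)) ⧸ N) →ₗ[ZMod (p ^ r)] ((Fin m → ZMod (p ^ r)) ⧸ N))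
    (hfbar : ∀ x : Fin m → ZMod (p ^ r),
      fbar (Submodule.Quotient.mk x) = Submodule.Quotient.mk (f x))
    (v : Fin m → ZMod (p ^ r))
    (hleaf : (Submodule.Quotient.mk v : (Fin m → ZMod (p ^ r)) ⧸ N) ∉ Set.range ⇑fbar)
    (hnil : ∃ t : ℕ, (⇑fbar)^[t] (Submodule.Quotient.mk v) = 0) :
    ∃ y : Fin m → ZMod (p ^ r),
      (Submodule.Quotient.mk y : (Fin m → ZMod (p ^ r)) ⧸ N) = Submodule.Quotient.mk v ∧
      y ∉ Set.range ⇑f ∧ ∃ s : ℕ, (⇑f)^[s] y = 0 := by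
  have : NeZero (p ^ r) := ⟨pow_ne_zero r hp.ne_zero⟩
  obtain ⟨t, ht⟩ := hnil
  obtain ⟨y, hyv, s, hs⟩ := Module.End.exists_mk_eq_and_pow_apply_eq_zero f fbar
    (LinearMap.ext hfbar) v t (by rwa [Module.End.pow_apply])
  refine ⟨y, hyv, ?_, s, by rwa [Module.End.pow_apply] at hs⟩
  rintro ⟨x, rfl⟩
  exact hleaf ⟨Submodule.Quotient.mk x, (hfbar x).trans hyv⟩
end

section
/- (Fitting's Lemma for finite modules.) Let M be a finite module over a commutative ring R and let f : M → M be an R-linear map. Then there exists a positive integer s such that, setting N = f^s(M) (the image of f^s) and T = f^{-s}(0) (the kernel of f^s), M is the internal direct sum of the submodules N and T, the restriction of f to N is a bijection of N onto itself, and the restriction of f to T is nilpotent (some iterate of f maps all of T to 0). -/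
/-- **Fitting's Lemma** for finite modules: there is a positive integer `s` such
that, with `N = f^s(M)` and `T = ker (f^s)`, `M` is the internal direct sum of
`N` and `T`, `f` restricted to `N` is a bijection of `N` onto itself, and `f`
restricted to `T` is nilpotent. -/
theorem fitting_lemma_finite_module
    {R M : Type*} [CommRing R] [AddCommGroup M] [Module R M] [Fintype M]
    (f : M →ₗ[R] M) :
    ∃ s : ℕ, 0 < s ∧
      LinearMap.range ((f : Module.End R M) ^ s) ⊓
          LinearMap.ker ((f : Module.End R M) ^ s) = ⊥ ∧
      LinearMap.range ((f : Module.End R M) ^ s) ⊔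
          LinearMap.ker ((f : Module.End R M) ^ s) = ⊤ ∧
      Set.BijOn ⇑f (LinearMap.range ((f : Module.End R M) ^ s) : Set M)
        (LinearMap.range ((f : Module.End R M) ^ s) : Set M) ∧
      ∃ k : ℕ, ∀ x ∈ LinearMap.ker ((f : Module.End R M) ^ s), (⇑f)^[k] x = 0 := by
  obtain ⟨s, hc, hs⟩ :=
    (f.eventually_isCompl_ker_pow_range_pow.and (Filter.eventually_gt_atTop 0)).exists
  obtain ⟨n, rfl⟩ := Nat.exists_eq_succ_of_ne_zero hs.ne'
  refine ⟨n + 1, hs, hc.symm.inf_eq_bot, hc.symm.sup_eq_top, ⟨?_, ?_, ?_⟩, n + 1, ?_⟩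
  · rintro _ ⟨y, rfl⟩
    exact ⟨f y, by rw [← Module.End.mul_apply, ← Module.End.mul_apply, ← pow_succ, ← pow_succ']⟩
  · intro x hx y hy hxy
    have hker : x - y ∈ LinearMap.ker ((f : Module.End R M) ^ (n + 1)) := by
      rw [LinearMap.mem_ker, pow_succ, Module.End.mul_apply, map_sub, hxy, sub_self, map_zero]
    exact sub_eq_zero.mp (Submodule.disjoint_def.mp hc.disjoint _ hker (Submodule.sub_mem _ hx hy))
  · rintro _ ⟨y, rfl⟩
    obtain ⟨t, ht, _, ⟨z, rfl⟩, rfl⟩ :=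
      Submodule.mem_sup.mp (hc.sup_eq_top ▸ Submodule.mem_top : y ∈ _ ⊔ _)
    refine ⟨((f : Module.End R M) ^ (n + 1)) (((f : Module.End R M) ^ n) z), ⟨_, rfl⟩, ?_⟩
    rw [map_add, LinearMap.mem_ker.mp ht, zero_add]
    simp only [← Module.End.mul_apply]
    congr 1
    simp only [← pow_succ', ← pow_add]
    rfl
  · intro x hx
    rw [← Module.End.pow_apply]
    exact hx
end

section
/- Let n ≥ 2 and m ≥ 1, let A be an m × m matrix over Z_n, and let h be any nonnegative integer that is an upper bound for the system height of ((Z_n)^m, x ↦ A x). Then ((Z_n)^m, x ↦ A x) is a fixed point system (i.e., for every x in (Z_n)^m there exists a nonnegative integer k and an element x_0 with A^k x = x_0 and A x_0 = x_0) if and only if A^{h+1} = A^h. -/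
theorem iterate_eq_of_isFixedPt {M : Type*} {f : M → M} {x : M} {i j : ℕ}
    (hx : Function.IsFixedPt f (f^[i] x)) (hij : i ≤ j) : f^[j] x = f^[i] x := by
  obtain ⟨d, rfl⟩ := Nat.exists_eq_add_of_le' hij
  rw [Function.iterate_add_apply]
  exact hx.iterate d

/-- A cycle vertex that iterates to a fixed point is itself fixed. -/
theorem IsCycleVertex.isFixedPt {M : Type*} {f : M → M} {y : M} (hy : IsCycleVertex f y)
    {k : ℕ} (hk : Function.IsFixedPt f (f^[k] y)) : Function.IsFixedPt f y := by
  obtain ⟨l, hl, hly⟩ := hy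
  have hper : f^[l * k] y = y := Function.IsPeriodicPt.mul_const (m := l) hly k
  rw [← hper, iterate_eq_of_isFixedPt hk (Nat.le_mul_of_pos_left k hl)]
  exact hk

/-- An element iterating to a fixed point does so after exactly `height f x` steps. -/
theorem isFixedPt_iterate_height {M : Type*} {f : M → M} {x : M} {k : ℕ}
    (hk : Function.IsFixedPt f (f^[k] x)) : Function.IsFixedPt f (f^[height f x] x) := by
  have hne : {k : ℕ | IsCycleVertex f (f^[k] x)}.Nonempty := ⟨k, 1, one_pos, hk⟩
  refine IsCycleVertex.isFixedPt (k := k) (Nat.sInf_mem hne) ?_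
  rw [← Function.iterate_add_apply, iterate_eq_of_isFixedPt hk (Nat.le_add_right k _)]
  exact hk

theorem height_le_systemHeight {M : Type*} [Finite M] (f : M → M) (x : M) :
    height f x ≤ systemHeight f :=
  le_csSup (Set.finite_range _).bddAbove (Set.mem_range_self x)

theorem Matrix.pow_mulVec_eq_iterate {ι R : Type*} [Fintype ι] [DecidableEq ι] [Semiring R]
    (A : Matrix ι ι R) (k : ℕ) (x : ι → R) : (A ^ k).mulVec x = A.mulVec^[k] x := by
  induction k with
  | zero => simp
  | succ k ih => rw [pow_succ', ← Matrix.mulVec_mulVec, ih, Function.iterate_succ_apply']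

/-- Fixed point system criterion: if `h` is any upper bound on the system height
of `((ZMod n)^m, x ↦ A x)`, then the system is a fixed point system (every
element iterates to a fixed point) if and only if `A^(h+1) = A^h`. -/
theorem fixedPointSystem_iff_pow_succ_eq_pow
    (n m : ℕ) (hn : 2 ≤ n) (hm : 1 ≤ m)
    (A : Matrix (Fin m) (Fin m) (ZMod n))
    (h : ℕ) (hh : systemHeight A.mulVec ≤ h) :
    (∀ x : Fin m → ZMod n, ∃ (k : ℕ) (x₀ : Fin m → ZMod n),
        (A ^ k).mulVec x = x₀ ∧ A.mulVec x₀ = x₀) ↔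
      A ^ (h + 1) = A ^ h := by
  have : NeZero n := ⟨by omega⟩
  constructor
  · intro hfix
    refine Matrix.mulVec_injective (funext fun x => ?_)
    obtain ⟨k, _, rfl, hk⟩ := hfix x
    rw [Matrix.pow_mulVec_eq_iterate] at hk
    have hfixed := isFixedPt_iterate_height hk
    have hle := (height_le_systemHeight A.mulVec x).trans hh
    rw [Matrix.pow_mulVec_eq_iterate, Matrix.pow_mulVec_eq_iterate,
      iterate_eq_of_isFixedPt hfixed hle, iterate_eq_of_isFixedPt hfixed (hle.trans h.le_succ)]
  · intro hA x
    exact ⟨h, _, rfl, by rw [Matrix.mulVec_mulVec, ← pow_succ', hA]⟩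
end
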